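/- The real polynomial p₁₀(u) = 72 − 468u + 216u² − 256u⁴ + 3744u⁵ − 15225u⁶ + 11544u⁷ − 2412u⁸ + 416u^{13} − 192u^{14} has no real zero in the open interval (2, 13/6); the real polynomial p₁₃(u) = 20·2^{5/8} − 54·2^{1/4}·u − 8√2·u³ + 80·2^{1/8}·u⁴ − 26u⁷ + 4·2^{5/8}·u⁸ − 4√2·u^{11} has exactly one real zero in (0, ∞), and it is simple; and the real polynomial p₁₄(u) = 20·2^{5/8} − 54·2^{1/4}·u + 8√2·u³ − 80·2^{1/8}·u⁴ − 26u⁷ + 4·2^{5/8}·u⁸ + 4√2·u^{11} has exactly one real zero in (−∞, 0), and it is simple. -/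

import Mathlib

/-- The polynomial `p₁₃(u) = 20·2^{5/8} - 54·2^{1/4} u - 8√2 u³ + 80·2^{1/8} u⁴
- 26u⁷ + 4·2^{5/8} u⁸ - 4√2 u¹¹`. -/
noncomputable def chazyp13 (u : ℝ) : ℝ :=
  20 * (2 : ℝ) ^ ((5 : ℝ) / 8) - 54 * (2 : ℝ) ^ ((1 : ℝ) / 4) * u
    - 8 * Real.sqrt 2 * u ^ 3 + 80 * (2 : ℝ) ^ ((1 : ℝ) / 8) * u ^ 4
    - 26 * u ^ 7 + 4 * (2 : ℝ) ^ ((5 : ℝ) / 8) * u ^ 8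
    - 4 * Real.sqrt 2 * u ^ 11

/-- The polynomial `p₁₄(u) = 20·2^{5/8} - 54·2^{1/4} u + 8√2 u³ - 80·2^{1/8} u⁴
- 26u⁷ + 4·2^{5/8} u⁸ + 4√2 u¹¹`. -/
noncomputable def chazyp14 (u : ℝ) : ℝ :=
  20 * (2 : ℝ) ^ ((5 : ℝ) / 8) - 54 * (2 : ℝ) ^ ((1 : ℝ) / 4) * u
    + 8 * Real.sqrt 2 * u ^ 3 - 80 * (2 : ℝ) ^ ((1 : ℝ) / 8) * u ^ 4
    - 26 * u ^ 7 + 4 * (2 : ℝ) ^ ((5 : ℝ) / 8) * u ^ 8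
    + 4 * Real.sqrt 2 * u ^ 11

/-- The polynomial with `chazyp13 (2 ^ (3 / 8) * t) = 2 ^ (5 / 8) * reducedP13 t`. -/
def reducedP13 (x : ℝ) : ℝ :=
  20 - 54 * x - 16 * x ^ 3 + 160 * x ^ 4 - 104 * x ^ 7 + 32 * x ^ 8 - 64 * x ^ 11

/-- The polynomial with `chazyp14 (-2 ^ (3 / 8) * t) = 2 ^ (5 / 8) * reducedP14 t`. -/
def reducedP14 (x : ℝ) : ℝ :=
  20 + 54 * x - 16 * x ^ 3 - 160 * x ^ 4 + 104 * x ^ 7 + 32 * x ^ 8 - 64 * x ^ 11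

/-- The derivative of `reducedP13`. -/
def reducedP13Deriv (x : ℝ) : ℝ :=
  -54 - 48 * x ^ 2 + 640 * x ^ 3 - 728 * x ^ 6 + 256 * x ^ 7 - 704 * x ^ 10

/-- The derivative of `reducedP14`. -/
def reducedP14Deriv (x : ℝ) : ℝ :=
  54 - 48 * x ^ 2 - 640 * x ^ 3 + 728 * x ^ 6 + 256 * x ^ 7 - 704 * x ^ 10

theorem hasDerivAt_reducedP13 (x : ℝ) : HasDerivAt reducedP13 (reducedP13Deriv x) x := by
  have h (n : ℕ) (c : ℝ) : HasDerivAt (fun y : ℝ => c * y ^ n) (c * (n * x ^ (n - 1))) x :=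
    (hasDerivAt_pow n x).const_mul c
  refine HasDerivAt.congr_deriv
    (((((((hasDerivAt_const x (20 : ℝ)).sub ((hasDerivAt_id x).const_mul 54)).sub
      (h 3 16)).add (h 4 160)).sub (h 7 104)).add (h 8 32)).sub (h 11 64)) ?_
  rw [reducedP13Deriv]
  norm_num
  ring

theorem hasDerivAt_reducedP14 (x : ℝ) : HasDerivAt reducedP14 (reducedP14Deriv x) x := by
  have h (n : ℕ) (c : ℝ) : HasDerivAt (fun y : ℝ => c * y ^ n) (c * (n * x ^ (n - 1))) x :=
    (hasDerivAt_pow n x).const_mul c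
  refine HasDerivAt.congr_deriv
    (((((((hasDerivAt_const x (20 : ℝ)).add ((hasDerivAt_id x).const_mul 54)).sub
      (h 3 16)).sub (h 4 160)).add (h 7 104)).add (h 8 32)).sub (h 11 64)) ?_
  rw [reducedP14Deriv]
  norm_num
  ring

theorem chazyp10_pos {x : ℝ} (hx : 2 < x) (hx' : x ≤ 13 / 6) :
    0 < 72 - 468 * x + 216 * x ^ 2 - 256 * x ^ 4 + 3744 * x ^ 5 - 15225 * x ^ 6
      + 11544 * x ^ 7 - 2412 * x ^ 8 + 416 * x ^ 13 - 192 * x ^ 14 := by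
  have bernstein : ∀ s r : ℝ, 0 < s → 0 ≤ r → 0 <
      263616 * r ^ 14 + 22345164 * s * r ^ 13 + 874279824 * s ^ 2 * r ^ 12
      + 20908026048 * s ^ 3 * r ^ 11 + 341002865508 * s ^ 4 * r ^ 10
      + 4005930576900 * s ^ 5 * r ^ 9 + 34878872146719 * s ^ 6 * r ^ 8
      + 227957021696232 * s ^ 7 * r ^ 7 + 1118862731118996 * s ^ 8 * r ^ 6
      + 4076586921439472 * s ^ 9 * r ^ 5 + 10734512006258320 * s ^ 10 * r ^ 4
      + 19416588915459072 * s ^ 11 * r ^ 3 + 21854950463082496 * s ^ 12 * r ^ 2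
      + 12141212168699552 * s ^ 13 * r + 1120116399980544 * s ^ 14 := by
    intro s r hs hr
    positivity
  linarith [bernstein (x - 2) (13 - 6 * x) (by linarith) (by linarith)]

theorem reducedP13_pos_left {x : ℝ} (hx : 0 < x) (hx' : x ≤ 1 / 2) :
    0 < reducedP13 x := by
  unfold reducedP13
  have bernstein : ∀ s r : ℝ, 0 < s → 0 ≤ r → 0 <
      10 * r ^ 11 + 193 * s * r ^ 10 + 1660 * s ^ 2 * r ^ 9 + 8332 * s ^ 3 * r ^ 8
      + 26832 * s ^ 4 * r ^ 7 + 57344 * s ^ 5 * r ^ 6 + 81088 * s ^ 6 * r ^ 5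
      + 72908 * s ^ 7 * r ^ 4 + 37744 * s ^ 8 * r ^ 3 + 8832 * s ^ 9 * r ^ 2 + 576 * s ^ 10 * r
      + 288 * s ^ 11 := by
    intro s r hs hr
    positivity
  linarith [bernstein (x) (1 - 2 * x) (by linarith) (by linarith)]

theorem reducedP13_pos_right {x : ℝ} (hx : 1 / 2 < x) (hx' : x ≤ 9 / 10) :
    0 < reducedP13 x := by
  unfold reducedP13
  have bernstein : ∀ s r : ℝ, 0 < s → 0 ≤ r → 0 <
      9 * r ^ 11 + 747 * s * r ^ 10 + 44799 * s ^ 2 * r ^ 9 + 1384565 * s ^ 3 * r ^ 8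
      + 24248410 * s ^ 4 * r ^ 7 + 264035534 * s ^ 5 * r ^ 6 + 1875799198 * s ^ 6 * r ^ 5
      + 8808965034 * s ^ 7 * r ^ 4 + 26797050509 * s ^ 8 * r ^ 3 + 49400294615 * s ^ 9 * r ^ 2
      + 46798753139 * s ^ 10 * r + 13531554641 * s ^ 11 := by
    intro s r hs hr
    positivity
  linarith [bernstein (2 * x - 1) (9 - 10 * x) (by linarith) (by linarith)]

theorem reducedP14_pos {x : ℝ} (hx : 0 < x) (hx' : x ≤ 4 / 5) :
    0 < reducedP14 x := by
  unfold reducedP14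
  have bernstein : ∀ s r : ℝ, 0 < s → 0 ≤ r → 0 <
      5 * r ^ 11 + 329 * s * r ^ 10 + 9575 * s ^ 2 * r ^ 9 + 163619 * s ^ 3 * r ^ 8
      + 1820770 * s ^ 4 * r ^ 7 + 13768650 * s ^ 5 * r ^ 6 + 71450750 * s ^ 6 * r ^ 5
      + 250519734 * s ^ 7 * r ^ 4 + 568759593 * s ^ 8 * r ^ 3 + 774090045 * s ^ 9 * r ^ 2
      + 564110475 * s ^ 10 * r + 136151511 * s ^ 11 := by
    intro s r hs hr
    positivity
  linarith [bernstein (x) (4 - 5 * x) (by linarith) (by linarith)]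

theorem reducedP13Deriv_neg {x : ℝ} (hx : 9 / 10 ≤ x) :
    reducedP13Deriv x < 0 := by
  unfold reducedP13Deriv
  have shifted : ∀ s : ℝ, 0 ≤ s → 0 <
      21286666161 + 45086848290 * s + 24917717145 * s ^ 2 + 6953454080 * s ^ 3
      + 1263774960 * s ^ 4 + 163022328 * s ^ 5 + 15017660 * s ^ 6 + 958280 * s ^ 7
      + 40095 * s ^ 8 + 990 * s ^ 9 + 11 * s ^ 10 := by
    intro s hs
    positivity
  linarith [shifted (10 * x - 9) (by linarith)]

theorem reducedP14Deriv_neg {x : ℝ} (hx : 4 / 5 ≤ x) :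
    reducedP14Deriv x < 0 := by
  unfold reducedP14Deriv
  have shifted : ∀ s : ℝ, 0 ≤ s → 0 <
      661442877 + 341234880 * s + 129801240 * s ^ 2 + 282500160 * s ^ 3 + 212336320 * s ^ 4
      + 79996896 * s ^ 5 + 18248020 * s ^ 6 + 2687360 * s ^ 7 + 253440 * s ^ 8 + 14080 * s ^ 9
      + 352 * s ^ 10 := by
    intro s hs
    positivity
  linarith [shifted (5 * x - 4) (by linarith)]

/-- A function that is positive on `(0, c]`, strictly decreasing on `[c, ∞)` and negative
somewhere beyond `c` has exactly one positive zero, and that zero is simple. This is stated for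
the rescaled function `u ↦ a * q (u / k)`. -/
theorem exists_unique_simple_zero_of_rescaled {f q q' : ℝ → ℝ} {a k c d : ℝ} (ha : a ≠ 0)
    (hk : k ≠ 0) (hf : ∀ u, f u = a * q (u / k)) (hq : ∀ x, HasDerivAt q (q' x) x)
    (hc : 0 < c) (hcd : c < d) (hpos : ∀ x, 0 < x → x ≤ c → 0 < q x)
    (hneg : ∀ x, c ≤ x → q' x < 0) (hd : q d < 0) :
    ∃ u : ℝ, 0 < u / k ∧ f u = 0 ∧ deriv f u ≠ 0 ∧ ∀ v : ℝ, 0 < v / k → f v = 0 → v = u := by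
  have hcont : Continuous q := continuous_iff_continuousAt.2 fun x => (hq x).continuousAt
  have hanti : StrictAntiOn q (Set.Ici c) :=
    strictAntiOn_of_deriv_neg (convex_Ici c) hcont.continuousOn fun x hx => by
      rw [(hq x).deriv]
      exact hneg x (interior_subset hx)
  obtain ⟨t, ⟨hct, -⟩, ht⟩ :=
    intermediate_value_Icc' hcd.le hcont.continuousOn ⟨hd.le, (hpos c hc le_rfl).le⟩
  have htk : k * t / k = t := mul_div_cancel_left₀ t hk
  refine ⟨k * t, by rw [htk]; exact hc.trans_le hct, by rw [hf, htk, ht, mul_zero], ?_, ?_⟩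
  · have hderiv : HasDerivAt f (a * (q' t * (1 / k))) (k * t) := by
      rw [funext hf]
      refine HasDerivAt.const_mul a (HasDerivAt.comp (k * t) ?_
        ((hasDerivAt_id (k * t)).div_const k))
      simpa only [id, htk] using hq t
    rw [hderiv.deriv]
    exact mul_ne_zero ha (mul_ne_zero (hneg t hct).ne (one_div_ne_zero hk))
  · intro v hv hv0
    have hqv : q (v / k) = 0 := by
      rw [hf] at hv0
      exact (mul_eq_zero.1 hv0).resolve_left ha
    have hcv : c ≤ v / k := by
      by_contra! h
      exact (hpos _ hv h.le).ne' hqv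
    have := hanti.injOn hcv hct (hqv.trans ht.symm)
    rw [← this, mul_div_cancel₀ v hk]

theorem two_rpow_div_eight (n : ℕ) : (2 : ℝ) ^ ((n : ℝ) / 8) = ((2 : ℝ) ^ ((1 : ℝ) / 8)) ^ n := by
  rw [← Real.rpow_natCast, ← Real.rpow_mul (by norm_num)]
  congr 1
  ring

theorem sqrt_two_eq : Real.sqrt 2 = ((2 : ℝ) ^ ((1 : ℝ) / 8)) ^ 4 := by
  rw [Real.sqrt_eq_rpow, ← two_rpow_div_eight]
  norm_num

theorem two_rpow_five_eighths : (2 : ℝ) ^ ((5 : ℝ) / 8) = ((2 : ℝ) ^ ((1 : ℝ) / 8)) ^ 5 :=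
  mod_cast two_rpow_div_eight 5

theorem two_rpow_quarter : (2 : ℝ) ^ ((1 : ℝ) / 4) = ((2 : ℝ) ^ ((1 : ℝ) / 8)) ^ 2 := by
  rw [← two_rpow_div_eight]
  norm_num

theorem two_rpow_eighth_pow_eight : ((2 : ℝ) ^ ((1 : ℝ) / 8)) ^ 8 = 2 := by
  rw [← two_rpow_div_eight]
  norm_num

theorem chazyp13_eq_reduced (u : ℝ) : chazyp13 u =
    ((2 : ℝ) ^ ((1 : ℝ) / 8)) ^ 5 * reducedP13 (u / ((2 : ℝ) ^ ((1 : ℝ) / 8)) ^ 3) := by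
  have ha8 := two_rpow_eighth_pow_eight
  have ha : (2 : ℝ) ^ ((1 : ℝ) / 8) ≠ 0 := by positivity
  rw [chazyp13, reducedP13, two_rpow_five_eighths, two_rpow_quarter, sqrt_two_eq]
  generalize (2 : ℝ) ^ ((1 : ℝ) / 8) = a at *
  obtain ⟨t, rfl⟩ : ∃ t, u = a ^ 3 * t := ⟨u / a ^ 3, by field_simp⟩
  rw [mul_div_cancel_left₀ t (by simpa using ha)]
  linear_combination (-8 * a ^ 5 * t ^ 3
      + 80 * a ^ 5 * t ^ 4
      - 26 * a ^ 5 * t ^ 7 * (2 + a ^ 8)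
      + 4 * a ^ 5 * t ^ 8 * (4 + 2 * a ^ 8 + a ^ 16)
      - 4 * a ^ 5 * t ^ 11 * (8 + 4 * a ^ 8 + 2 * a ^ 16 + a ^ 24)) * ha8

theorem chazyp14_eq_reduced (u : ℝ) : chazyp14 u =
    ((2 : ℝ) ^ ((1 : ℝ) / 8)) ^ 5 * reducedP14 (u / (-((2 : ℝ) ^ ((1 : ℝ) / 8)) ^ 3)) := by
  have ha8 := two_rpow_eighth_pow_eight
  have ha : (2 : ℝ) ^ ((1 : ℝ) / 8) ≠ 0 := by positivity
  rw [chazyp14, reducedP14, two_rpow_five_eighths, two_rpow_quarter, sqrt_two_eq]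
  generalize (2 : ℝ) ^ ((1 : ℝ) / 8) = a at *
  obtain ⟨t, rfl⟩ : ∃ t, u = (-a ^ 3) * t := ⟨u / (-a ^ 3), by field_simp⟩
  rw [mul_div_cancel_left₀ t (by simpa using ha)]
  linear_combination (-8 * a ^ 5 * t ^ 3
      - 80 * a ^ 5 * t ^ 4
      + 26 * a ^ 5 * t ^ 7 * (2 + a ^ 8)
      + 4 * a ^ 5 * t ^ 8 * (4 + 2 * a ^ 8 + a ^ 16)
      - 4 * a ^ 5 * t ^ 11 * (8 + 4 * a ^ 8 + 2 * a ^ 16 + a ^ 24)) * ha8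

/-- Sturm facts for `q = 3`: `p₁₀` has no real zero in `(2, 13/6)`; `p₁₃` has
exactly one real zero in `(0, ∞)`, and it is simple; `p₁₄` has exactly one real
zero in `(-∞, 0)`, and it is simple. -/
theorem chazy_q3_sturm_p10_p13_p14 :
    (∀ u ∈ Set.Ioo (2 : ℝ) (13 / 6),
      72 - 468 * u + 216 * u ^ 2 - 256 * u ^ 4 + 3744 * u ^ 5 - 15225 * u ^ 6
        + 11544 * u ^ 7 - 2412 * u ^ 8 + 416 * u ^ 13 - 192 * u ^ 14 ≠ 0) ∧
    (∃ u : ℝ, 0 < u ∧ chazyp13 u = 0 ∧ deriv chazyp13 u ≠ 0 ∧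
      ∀ v : ℝ, 0 < v → chazyp13 v = 0 → v = u) ∧
    (∃ u : ℝ, u < 0 ∧ chazyp14 u = 0 ∧ deriv chazyp14 u ≠ 0 ∧
      ∀ v : ℝ, v < 0 → chazyp14 v = 0 → v = u) := by
  have ha : 0 < (2 : ℝ) ^ ((1 : ℝ) / 8) := by positivity
  refine ⟨fun u hu => (chazyp10_pos hu.1 hu.2.le).ne', ?_, ?_⟩
  · have hpos : ∀ x : ℝ, 0 < x → x ≤ 9 / 10 → 0 < reducedP13 x := fun x hx hx' =>
      (le_or_gt x (1 / 2)).elim (reducedP13_pos_left hx) fun h => reducedP13_pos_right h hx'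
    obtain ⟨u, hu, h0, h1, h2⟩ := exists_unique_simple_zero_of_rescaled (pow_ne_zero 5 ha.ne')
      (pow_ne_zero 3 ha.ne') chazyp13_eq_reduced hasDerivAt_reducedP13 (by norm_num)
      (by norm_num : (9 / 10 : ℝ) < 1) hpos (fun _ => reducedP13Deriv_neg)
      (by norm_num [reducedP13])
    exact ⟨u, (div_pos_iff_of_pos_right (pow_pos ha 3)).1 hu, h0, h1,
      fun v hv => h2 v (div_pos hv (pow_pos ha 3))⟩
  · have hk : -((2 : ℝ) ^ ((1 : ℝ) / 8)) ^ 3 < 0 := neg_neg_of_pos (pow_pos ha 3)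
    obtain ⟨u, hu, h0, h1, h2⟩ := exists_unique_simple_zero_of_rescaled (pow_ne_zero 5 ha.ne')
      hk.ne chazyp14_eq_reduced hasDerivAt_reducedP14 (by norm_num)
      (by norm_num : (4 / 5 : ℝ) < 1) (fun _ => reducedP14_pos) (fun _ => reducedP14Deriv_neg)
      (by norm_num [reducedP14])
    exact ⟨u, (div_pos_iff.1 hu).resolve_left (fun h => h.2.not_gt hk) |>.1, h0, h1,
      fun v hv => h2 v (div_pos_of_neg_of_neg hv hk)⟩
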